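/- Let d, L ∈ ℕ, let n ≥ 2, let R ≥ 1 with R · D_max ≥ 2, and let σ_1, …, σ_L be activation functions satisfying the Lipschitz and linear-growth conditions with constants c, c_1 ≥ 1. Then there exists a constant C > 0 depending only on c, c_0, c_1, d and r such that dist(Lip^{(r,c_0)}, H_{n,L,σ,R}, L^1(𝕀^d)) ≥ C · [L² n log₂ n · log₂(R · D_max)]^{−r/d}, where D_max := max_{0 ≤ ℓ ≤ L} d_ℓ. -/

import Mathlib

open MeasureTheory ENNReal

noncomputable section

/-- The cube `𝕀^d = [-1,1]^d` in Euclidean space. -/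
def cube (d : ℕ) : Set (EuclideanSpace ℝ (Fin d)) := { x | ∀ i, |x i| ≤ 1 }

/-- The `L¹(𝕀^d)` distance between two functions on the cube. -/
def L1dist {d : ℕ} (f g : EuclideanSpace ℝ (Fin d) → ℝ) : ℝ :=
  ∫ x in cube d, |f x - g x|

/-- `coverNum ρ ε V` is the `ε`-covering number of `V` with respect to the
distance `ρ` : the minimal number of elements of an `ε`-net for `V`. -/
def coverNum {α : Type*} (ρ : α → α → ℝ) (ε : ℝ) (V : Set α) : ℝ≥0∞ :=
  sInf { m : ℝ≥0∞ | ∃ T : Finset α, (T.card : ℝ≥0∞) = m ∧ ∀ v ∈ V, ∃ t ∈ T, ρ v t ≤ ε }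

/-- An entry of a weight matrix / threshold vector is either a prescribed fixed
real number (`Sum.inl`) or one of `n` shared free parameters (`Sum.inr`);
`paramEval θ` realizes it given the values `θ` of the free parameters. -/
def paramEval {n : ℕ} (θ : Fin n → ℝ) : ℝ ⊕ Fin n → ℝ := Sum.elim id θ

/-- Layer widths : `dimAt d dims 0 = d` (input dimension `d₀ = d`) and
`dimAt d dims k = dims k` for the hidden layers `k ≥ 1`. -/
def dimAt (d : ℕ) (dims : ℕ → ℕ) : ℕ → ℕ
  | 0 => d
  | k + 1 => dims (k + 1)

/-- A fixed network structure with (at most) `n` free parameters, `L` hidden layers,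
input dimension `d` and widths `dims` : each entry of each weight matrix `W k`
(connecting layer `k` to layer `k+1`), of each threshold vector `b k` and of the
outer weight vector `a` is either a prescribed fixed constant or one of the `n`
shared free parameters. -/
structure NetStructure (n L d : ℕ) (dims : ℕ → ℕ) where
  W : (k : ℕ) → Fin (dimAt d dims (k + 1)) → Fin (dimAt d dims k) → ℝ ⊕ Fin n
  b : (k : ℕ) → Fin (dimAt d dims (k + 1)) → ℝ ⊕ Fin n
  a : Fin (dimAt d dims L) → ℝ ⊕ Fin n

/-- The vector of hidden-layer functions `h_k` of the deep net:
`h_0(x) = x`, `h_{k+1}(x) = σ_{k+1}(W_{k+1} h_k(x) + b_{k+1})`. -/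
def hiddenEval {n d : ℕ} {dims : ℕ → ℕ}
    (W : (k : ℕ) → Fin (dimAt d dims (k + 1)) → Fin (dimAt d dims k) → ℝ ⊕ Fin n)
    (b : (k : ℕ) → Fin (dimAt d dims (k + 1)) → ℝ ⊕ Fin n)
    (σ : ℕ → ℝ → ℝ) (θ : Fin n → ℝ) :
    (k : ℕ) → EuclideanSpace ℝ (Fin d) → Fin (dimAt d dims k) → ℝ
  | 0 => fun x i => x i
  | k + 1 => fun x i =>
      σ (k + 1) ((∑ j, paramEval θ (W k i j) * hiddenEval W b σ θ k x j) + paramEval θ (b k i))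

/-- The deep net realized by the structure `S`, activations `σ` and parameters `θ`:
`h(x) = a ⬝ h_L(x)`. -/
def NetStructure.eval {n L d : ℕ} {dims : ℕ → ℕ} (S : NetStructure n L d dims)
    (σ : ℕ → ℝ → ℝ) (θ : Fin n → ℝ) (x : EuclideanSpace ℝ (Fin d)) : ℝ :=
  ∑ i, paramEval θ (S.a i) * hiddenEval S.W S.b σ θ L x i

/-- All weights and thresholds (realized entries) are bounded by `R`. -/
def NetStructure.Bounded {n L d : ℕ} {dims : ℕ → ℕ} (S : NetStructure n L d dims)
    (R : ℝ) (θ : Fin n → ℝ) : Prop :=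
  (∀ k < L, ∀ i j, |paramEval θ (S.W k i j)| ≤ R) ∧
    (∀ k < L, ∀ i, |paramEval θ (S.b k i)| ≤ R) ∧
    (∀ i, |paramEval θ (S.a i)| ≤ R)

/-- The class `H_{n,L,σ,R}` of deep nets with the fixed structure `S`, whose
weights and thresholds are bounded by `R`. -/
def netClass {n L d : ℕ} {dims : ℕ → ℕ} (S : NetStructure n L d dims)
    (σ : ℕ → ℝ → ℝ) (R : ℝ) : Set (EuclideanSpace ℝ (Fin d) → ℝ) :=
  { f | ∃ θ : Fin n → ℝ, S.Bounded R θ ∧ f = S.eval σ θ }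

/-- Partial derivative of `f` in the `i`-th coordinate direction. -/
def pderiv' {d : ℕ} (i : Fin d) (f : EuclideanSpace ℝ (Fin d) → ℝ) :
    EuclideanSpace ℝ (Fin d) → ℝ :=
  fun x => fderiv ℝ f x (EuclideanSpace.single i 1)

/-- Iterated partial derivative of `f` along the list of coordinate directions `l`
(a list of length `s` corresponds to a multi-index `α` with `|α| = s`). -/
def iterPD {d : ℕ} : List (Fin d) → (EuclideanSpace ℝ (Fin d) → ℝ) →
    EuclideanSpace ℝ (Fin d) → ℝ
  | [], f => f
  | i :: l, f => iterPD l (pderiv' i f)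

/-- The class `Lip^{(r,c₀)}` (with `r = s + v`, `0 < v ≤ 1`) of `(r,c₀)`-smooth
functions on `𝕀^d` : `f` is `s`-times differentiable and every `s`-th order
partial derivative is `v`-Hölder continuous on `𝕀^d` with constant `c₀`
(with respect to the Euclidean norm). -/
def LipClass (d s : ℕ) (v c0 : ℝ) : Set (EuclideanSpace ℝ (Fin d) → ℝ) :=
  { f | ContDiff ℝ s f ∧
      ∀ l : List (Fin d), l.length = s →
        ∀ x ∈ cube d, ∀ y ∈ cube d,
          |iterPD l f x - iterPD l f y| ≤ c0 * ‖x - y‖ ^ v }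

section Nets

variable {n L d : ℕ} {dims : ℕ → ℕ}

lemma abs_paramEval_sub_le {θ θ' : Fin n → ℝ} {η : ℝ} (hη : 0 ≤ η)
    (h : ∀ i, |θ i - θ' i| ≤ η) (p : ℝ ⊕ Fin n) :
    |paramEval θ p - paramEval θ' p| ≤ η := by
  rcases p with p | p
  · simpa [paramEval] using hη
  · simpa [paramEval] using h p

lemma dimAt_le_sup {k : ℕ} (hk : k ≤ L) :
    ((dimAt d dims k : ℕ) : ℝ) ≤ (((Finset.range (L + 1)).sup (dimAt d dims) : ℕ) : ℝ) := by
  exact_mod_cast Finset.le_sup (f := dimAt d dims) (Finset.mem_range.2 (by omega))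

lemma abs_sum_mul_le {m : ℕ} {D P Q : ℝ} (hm : (m : ℝ) ≤ D) (hP : 0 ≤ P) (hQ : 0 ≤ Q)
    {p q : Fin m → ℝ} (hp : ∀ i, |p i| ≤ P) (hq : ∀ i, |q i| ≤ Q) :
    |∑ i, p i * q i| ≤ D * (P * Q) := by
  calc |∑ i, p i * q i| ≤ ∑ i, |p i * q i| := Finset.abs_sum_le_sum_abs _ _
    _ ≤ ∑ _i : Fin m, P * Q := by
        gcongr with i
        rw [abs_mul]
        exact mul_le_mul (hp i) (hq i) (abs_nonneg _) hP
    _ = m * (P * Q) := by simp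
    _ ≤ D * (P * Q) := by gcongr

lemma abs_sum_mul_sub_le {m : ℕ} {D P Q η Δ : ℝ} (hm : (m : ℝ) ≤ D) (hP : 0 ≤ P) (hQ : 0 ≤ Q)
    (hη : 0 ≤ η) (hΔ : 0 ≤ Δ) {p p' q q' : Fin m → ℝ} (hp' : ∀ i, |p' i| ≤ P)
    (hq : ∀ i, |q i| ≤ Q) (hp : ∀ i, |p i - p' i| ≤ η) (hqq : ∀ i, |q i - q' i| ≤ Δ) :
    |∑ i, p i * q i - ∑ i, p' i * q' i| ≤ D * (η * Q) + D * (P * Δ) := by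
  have : ∑ i, p i * q i - ∑ i, p' i * q' i
      = ∑ i, (p i - p' i) * q i + ∑ i, p' i * (q i - q' i) := by
    rw [← Finset.sum_sub_distrib, ← Finset.sum_add_distrib]
    exact Finset.sum_congr rfl fun i _ => by ring
  rw [this]
  exact (abs_add_le _ _).trans (add_le_add (abs_sum_mul_le hm hη hQ hp hq)
    (abs_sum_mul_le hm hP hΔ hp' hqq))

variable (S : NetStructure n L d dims) {σ : ℕ → ℝ → ℝ} {c c1 R D : ℝ}

lemma abs_hiddenEval_le (hc : 1 ≤ c) (hc1 : 1 ≤ c1) (hR : 1 ≤ R) (hD : 1 ≤ D)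
    (hdim : ∀ k ≤ L, ((dimAt d dims k : ℕ) : ℝ) ≤ D)
    (hgrow : ∀ k, 1 ≤ k → k ≤ L → ∀ t : ℝ, |σ k t| ≤ c * (|t| + 1))
    {θ : Fin n → ℝ} (hθ : S.Bounded R θ) {x : EuclideanSpace ℝ (Fin d)} (hx : x ∈ cube d) :
    ∀ k ≤ L, ∀ i, |hiddenEval S.W S.b σ θ k x i| ≤ (3 * c * c1 * (R * D)) ^ k := by
  intro k
  induction k with
  | zero => intro _ i; simpa [hiddenEval] using hx i
  | succ k ih =>
    intro hk i
    have hRD : 1 ≤ R * D := one_le_mul_of_one_le_of_one_le hR hD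
    have hcc : 1 ≤ c * c1 := one_le_mul_of_one_le_of_one_le hc hc1
    set B := 3 * c * c1 * (R * D) with hB
    have hB1 : 1 ≤ B := by
      have := one_le_mul_of_one_le_of_one_le hcc hRD
      rw [hB]; linarith
    have hBk : 1 ≤ B ^ k := one_le_pow₀ hB1
    have h1 := abs_sum_mul_le (hdim k (by omega)) (by linarith) (by linarith)
      (hθ.1 k (by omega) i) (ih (by omega))
    have h2 := hθ.2.1 k (by omega) i
    simp only [hiddenEval]
    refine (hgrow (k + 1) (by omega) hk _).trans ?_
    have h3 := (abs_add_le (∑ j, paramEval θ (S.W k i j) * hiddenEval S.W S.b σ θ k x j)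
      (paramEval θ (S.b k i))).trans (add_le_add h1 h2)
    have h4 : R ≤ R * D * B ^ k := by
      have : R ≤ R * D := le_mul_of_one_le_right (by linarith) hD
      nlinarith
    have h5 : 1 ≤ R * D * B ^ k := one_le_mul_of_one_le_of_one_le hRD hBk
    calc c * (_ + 1) ≤ c * (3 * (R * D * B ^ k)) := by
          gcongr
          linarith
      _ = (3 * c * (R * D)) * B ^ k := by ring
      _ ≤ B * B ^ k := by
          gcongr
          rw [hB]
          have : 0 ≤ 3 * c * (R * D) := by positivity
          nlinarith
      _ = B ^ (k + 1) := by ring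

lemma abs_hiddenEval_sub_le (hc : 1 ≤ c) (hc1 : 1 ≤ c1) (hR : 1 ≤ R) (hD : 1 ≤ D)
    (hdim : ∀ k ≤ L, ((dimAt d dims k : ℕ) : ℝ) ≤ D)
    (hlip : ∀ k, 1 ≤ k → k ≤ L → ∀ t t' : ℝ, |σ k t - σ k t'| ≤ c1 * |t - t'|)
    (hgrow : ∀ k, 1 ≤ k → k ≤ L → ∀ t : ℝ, |σ k t| ≤ c * (|t| + 1))
    {θ θ' : Fin n → ℝ} (hθ : S.Bounded R θ) (hθ' : S.Bounded R θ') {η : ℝ} (hη : 0 ≤ η)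
    (h : ∀ i, |θ i - θ' i| ≤ η) {x : EuclideanSpace ℝ (Fin d)} (hx : x ∈ cube d) :
    ∀ k ≤ L, ∀ i, |hiddenEval S.W S.b σ θ k x i - hiddenEval S.W S.b σ θ' k x i|
      ≤ η * (3 * c * c1 * (R * D)) ^ k := by
  intro k
  induction k with
  | zero => intro _ i; simpa [hiddenEval] using hη
  | succ k ih =>
    intro hk i
    have hRD : 1 ≤ R * D := one_le_mul_of_one_le_of_one_le hR hD
    have hcc : 1 ≤ c * c1 := one_le_mul_of_one_le_of_one_le hc hc1
    have hbd := abs_hiddenEval_le S hc hc1 hR hD hdim hgrow hθ hx k (by omega)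
    set B := 3 * c * c1 * (R * D) with hB
    have hB1 : 1 ≤ B := by
      have := one_le_mul_of_one_le_of_one_le hcc hRD
      rw [hB]; linarith
    have hBk : 1 ≤ B ^ k := one_le_pow₀ hB1
    have h1 := abs_sum_mul_sub_le (hdim k (by omega)) (by linarith) (by linarith) hη
      (by positivity) (hθ'.1 k (by omega) i) hbd
      (fun j => abs_paramEval_sub_le hη h (S.W k i j)) (ih (by omega))
    have h2 := abs_paramEval_sub_le hη h (S.b k i)
    simp only [hiddenEval]
    refine (hlip (k + 1) (by omega) hk _ _).trans ?_
    rw [add_sub_add_comm]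
    refine (mul_le_mul_of_nonneg_left ((abs_add_le _ _).trans (add_le_add h1 h2))
      (by linarith)).trans ?_
    have hDR : D ≤ R * D := le_mul_of_one_le_left (by linarith) hR
    have h4 : D * (η * B ^ k) ≤ R * D * (η * B ^ k) := by gcongr
    have h5 : η ≤ R * D * (η * B ^ k) := by
      have := mul_le_mul_of_nonneg_left (one_le_mul_of_one_le_of_one_le hRD hBk) hη
      linarith
    calc c1 * (_ + η) ≤ c1 * (3 * (R * D * (η * B ^ k))) := by
          gcongr
          linarith
      _ = (3 * 1 * c1 * (R * D)) * (η * B ^ k) := by ring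
      _ ≤ B * (η * B ^ k) := by rw [hB]; gcongr
      _ = η * B ^ (k + 1) := by ring

lemma NetStructure.abs_eval_sub_le (hc : 1 ≤ c) (hc1 : 1 ≤ c1) (hR : 1 ≤ R) (hD : 1 ≤ D)
    (hdim : ∀ k ≤ L, ((dimAt d dims k : ℕ) : ℝ) ≤ D)
    (hlip : ∀ k, 1 ≤ k → k ≤ L → ∀ t t' : ℝ, |σ k t - σ k t'| ≤ c1 * |t - t'|)
    (hgrow : ∀ k, 1 ≤ k → k ≤ L → ∀ t : ℝ, |σ k t| ≤ c * (|t| + 1))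
    {θ θ' : Fin n → ℝ} (hθ : S.Bounded R θ) (hθ' : S.Bounded R θ') {η : ℝ} (hη : 0 ≤ η)
    (h : ∀ i, |θ i - θ' i| ≤ η) {x : EuclideanSpace ℝ (Fin d)} (hx : x ∈ cube d) :
    |S.eval σ θ x - S.eval σ θ' x| ≤ η * (3 * c * c1 * (R * D)) ^ (L + 1) := by
  have hRD : 1 ≤ R * D := one_le_mul_of_one_le_of_one_le hR hD
  have hcc : 1 ≤ c * c1 := one_le_mul_of_one_le_of_one_le hc hc1
  have hbd := abs_hiddenEval_le S hc hc1 hR hD hdim hgrow hθ hx L le_rfl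
  have hdiff := abs_hiddenEval_sub_le S hc hc1 hR hD hdim hlip hgrow hθ hθ' hη h hx L le_rfl
  set B := 3 * c * c1 * (R * D) with hB
  have hB3 : 3 * (R * D) ≤ B := by
    rw [hB]; nlinarith
  have hBL : 0 ≤ B ^ L := by positivity
  have h1 := abs_sum_mul_sub_le (hdim L le_rfl) (by linarith) hBL hη
      (by positivity) hθ'.2.2 hbd (fun j => abs_paramEval_sub_le hη h (S.a j)) hdiff
  refine h1.trans ?_
  have hDR : D ≤ R * D := le_mul_of_one_le_left (by linarith) hR
  calc D * (η * B ^ L) + D * (R * (η * B ^ L)) = (D + R * D) * (η * B ^ L) := by ring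
    _ ≤ B * (η * B ^ L) := by gcongr; linarith
    _ = η * B ^ (L + 1) := by ring

lemma continuous_of_abs_sub_le {g : ℝ → ℝ} {K : ℝ}
    (h : ∀ t t' : ℝ, |g t - g t'| ≤ K * |t - t'|) : Continuous g := by
  refine LipschitzWith.continuous (K := K.toNNReal) (LipschitzWith.of_dist_le_mul fun t t' => ?_)
  rw [Real.dist_eq, Real.dist_eq]
  exact (h t t').trans (mul_le_mul_of_nonneg_right (Real.le_coe_toNNReal K) (abs_nonneg _))

lemma NetStructure.continuous_eval
    (hlip : ∀ k, 1 ≤ k → k ≤ L → ∀ t t' : ℝ, |σ k t - σ k t'| ≤ c1 * |t - t'|)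
    (θ : Fin n → ℝ) : Continuous (S.eval σ θ) := by
  have key : ∀ k ≤ L, ∀ i, Continuous fun x => hiddenEval S.W S.b σ θ k x i := by
    intro k
    induction k with
    | zero => intro _ i; simp only [hiddenEval]; fun_prop
    | succ k ih =>
      intro hk i
      have hσ : Continuous (σ (k + 1)) := continuous_of_abs_sub_le (hlip (k + 1) (by omega) hk)
      have ih' := ih (by omega)
      simp only [hiddenEval]
      exact hσ.comp ((continuous_finsetSum _ fun j _ => continuous_const.mul (ih' j)).add
        continuous_const)
  exact continuous_finsetSum _ fun i _ => continuous_const.mul (key L le_rfl i)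

/-- The part of the parameters a bounded network uses is unchanged by clamping to `[-R, R]`. -/
lemma NetStructure.Bounded.exists_clamp {S : NetStructure n L d dims} {θ : Fin n → ℝ}
    (hR : 0 ≤ R) (hθ : S.Bounded R θ) (σ : ℕ → ℝ → ℝ) :
    ∃ θ' : Fin n → ℝ, (∀ i, |θ' i| ≤ R) ∧ S.Bounded R θ' ∧ S.eval σ θ' = S.eval σ θ := by
  set θ' : Fin n → ℝ := fun i => if |θ i| ≤ R then θ i else 0 with hθ'
  have hp : ∀ p : ℝ ⊕ Fin n, |paramEval θ p| ≤ R → paramEval θ' p = paramEval θ p := by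
    rintro (p | p) h
    · rfl
    · simp only [paramEval, Sum.elim_inr] at h ⊢
      simp [hθ', h]
  have key : ∀ k ≤ L, hiddenEval S.W S.b σ θ' k = hiddenEval S.W S.b σ θ k := by
    intro k
    induction k with
    | zero => intro _; rfl
    | succ k ih =>
      intro hk
      funext x i
      simp only [hiddenEval]
      rw [ih (by omega), hp _ (hθ.2.1 k (by omega) i)]
      congr 2
      exact Finset.sum_congr rfl fun j _ => by rw [hp _ (hθ.1 k (by omega) i j)]
  refine ⟨θ', fun i => ?_, ⟨fun k hk i j => ?_, fun k hk i => ?_, fun i => ?_⟩, ?_⟩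
  · by_cases h : |θ i| ≤ R <;> simp [hθ', h, hR]
  · rw [hp _ (hθ.1 k hk i j)]; exact hθ.1 k hk i j
  · rw [hp _ (hθ.2.1 k hk i)]; exact hθ.2.1 k hk i
  · rw [hp _ (hθ.2.2 i)]; exact hθ.2.2 i
  · funext x
    simp only [NetStructure.eval]
    rw [key L le_rfl]
    exact Finset.sum_congr rfl fun i _ => by rw [hp _ (hθ.2.2 i)]

/-- A set is represented, up to equality of a finite label, by few of its points. -/
lemma exists_finset_representatives {α β : Type*} [Fintype β] (A : Set α) (q : α → β) :
    ∃ T : Finset α, (T : Set α) ⊆ A ∧ T.card ≤ Fintype.card β ∧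
      ∀ a ∈ A, ∃ t ∈ T, q a = q t := by
  classical
  rcases A.eq_empty_or_nonempty with rfl | ⟨a0, ha0⟩
  · exact ⟨∅, by simp⟩
  let g : β → α := fun y => if h : ∃ a ∈ A, q a = y then h.choose else a0
  refine ⟨Finset.univ.image g, ?_, Finset.card_image_le, fun a ha => ?_⟩
  · intro t ht
    obtain ⟨y, -, rfl⟩ := Finset.mem_image.1 (Finset.mem_coe.1 ht)
    by_cases h : ∃ a ∈ A, q a = y
    · simpa only [g, dif_pos h] using h.choose_spec.1
    · simpa only [g, dif_neg h] using ha0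
  · have h : ∃ a' ∈ A, q a' = q a := ⟨a, ha, rfl⟩
    refine ⟨g (q a), Finset.mem_image_of_mem _ (Finset.mem_univ _), ?_⟩
    simp only [g, dif_pos h]
    exact h.choose_spec.2.symm

lemma exists_finset_net (hc : 1 ≤ c) (hc1 : 1 ≤ c1) (hR : 1 ≤ R) (hD : 1 ≤ D)
    (hdim : ∀ k ≤ L, ((dimAt d dims k : ℕ) : ℝ) ≤ D)
    (hlip : ∀ k, 1 ≤ k → k ≤ L → ∀ t t' : ℝ, |σ k t - σ k t'| ≤ c1 * |t - t'|)
    (hgrow : ∀ k, 1 ≤ k → k ≤ L → ∀ t : ℝ, |σ k t| ≤ c * (|t| + 1))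
    {η : ℝ} (hη : 0 < η) :
    ∃ T : Finset (EuclideanSpace ℝ (Fin d) → ℝ), (∀ t ∈ T, Continuous t) ∧
      (T.card : ℝ) ≤ (2 * R / η + 1) ^ n ∧
      ∀ h ∈ netClass S σ R, Continuous h ∧ ∃ t ∈ T, ∀ x ∈ cube d,
        |h x - t x| ≤ η * (3 * c * c1 * (R * D)) ^ (L + 1) := by
  classical
  set A : Set (Fin n → ℝ) := {θ | (∀ i, |θ i| ≤ R) ∧ S.Bounded R θ}
  set K : ℕ := ⌊2 * R / η⌋₊
  have hK : ∀ t : ℝ, ⌊(min t R + R) / η⌋₊ < K + 1 := fun t => Nat.lt_succ_of_le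
    (Nat.floor_le_floor (by gcongr; linarith [min_le_right t R]))
  let q : (Fin n → ℝ) → (Fin n → Fin (K + 1)) := fun θ i => ⟨_, hK (θ i)⟩
  obtain ⟨T, hTA, hcard, hT⟩ := exists_finset_representatives A q
  refine ⟨T.image (S.eval σ), ?_, ?_, ?_⟩
  · intro t ht
    obtain ⟨θ, -, rfl⟩ := Finset.mem_image.1 ht
    exact S.continuous_eval hlip θ
  · have h1 : (T.image (S.eval σ)).card ≤ (K + 1) ^ n := by
      refine Finset.card_image_le.trans (hcard.trans ?_)
      simp
    calc (((T.image (S.eval σ)).card : ℕ) : ℝ) ≤ ((K + 1 : ℕ) : ℝ) ^ n := by exact_mod_cast h1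
      _ ≤ (2 * R / η + 1) ^ n := by
        push_cast
        gcongr
        exact Nat.floor_le (by positivity)
  · rintro h ⟨θ, hθ, rfl⟩
    refine ⟨S.continuous_eval hlip θ, ?_⟩
    obtain ⟨θ1, hθ1, hb1, he⟩ := hθ.exists_clamp (by linarith) σ
    obtain ⟨θ2, hθ2, hq⟩ := hT θ1 ⟨hθ1, hb1⟩
    have hA2 : θ2 ∈ A := hTA hθ2
    refine ⟨_, Finset.mem_image_of_mem _ hθ2, fun x hx => ?_⟩
    rw [← he]
    refine S.abs_eval_sub_le hc hc1 hR hD hdim hlip hgrow hb1 hA2.2 hη.le (fun i => ?_) hx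
    have hqi : ⌊(min (θ1 i) R + R) / η⌋₊ = ⌊(min (θ2 i) R + R) / η⌋₊ :=
      congrArg Fin.val (congrFun hq i)
    have b1 := abs_le.1 (hθ1 i)
    have b2 := abs_le.1 (hA2.1 i)
    rw [min_eq_left b1.2, min_eq_left b2.2] at hqi
    have l1 := Nat.floor_le (a := (θ1 i + R) / η) (div_nonneg (by linarith) hη.le)
    have l2 := Nat.floor_le (a := (θ2 i + R) / η) (div_nonneg (by linarith) hη.le)
    have u1 := Nat.lt_floor_add_one ((θ1 i + R) / η)
    have u2 := Nat.lt_floor_add_one ((θ2 i + R) / η)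
    rw [hqi] at l1 u1
    rw [le_div_iff₀ hη] at l1 l2
    rw [div_lt_iff₀ hη] at u1 u2
    rw [abs_le]
    constructor <;> nlinarith

end Nets

/-- Some sign pattern differs from each of few given patterns in more than a quarter of the
places. -/
lemma exists_signs_card_lt {α ι : Type*} [Fintype ι] (T : Finset α) (bad : α → ι → Bool)
    (hT : (T.card : ℝ) < (9 / 8 : ℝ) ^ Fintype.card ι) :
    ∃ ε : ι → Bool, ∀ t ∈ T,
      Fintype.card ι < 4 * (Finset.univ.filter fun j => ε j = bad t j).card := by
  classical
  by_contra! hcon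
  set m := Fintype.card ι
  have hsum : ∀ t : α, ∑ ε : ι → Bool, ((81 / 256 : ℝ)) ^
      (Finset.univ.filter fun j => ε j = bad t j).card = (1 + 81 / 256 : ℝ) ^ m := by
    intro t
    have h := Finset.prod_univ_sum (ι := ι) (fun _ => (Finset.univ : Finset Bool))
      (fun j e => if e = bad t j then (81 / 256 : ℝ) else 1)
    rw [Fintype.piFinset_univ] at h
    calc _ = ∑ ε : ι → Bool, ∏ j, (if ε j = bad t j then (81 / 256 : ℝ) else 1) := by
          refine Finset.sum_congr rfl fun ε _ => ?_
          rw [Finset.prod_ite]; simp [div_pow]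
      _ = _ := by
          rw [← h]
          rw [Finset.prod_congr rfl (g := fun _ => (1 + 81 / 256 : ℝ))]
          · simp [m]
          · intro j _
            cases bad t j <;> simp [add_comm]
  have hlow : ∀ ε : ι → Bool, (3 / 4 : ℝ) ^ m ≤ ∑ t ∈ T, (81 / 256 : ℝ) ^
      (Finset.univ.filter fun j => ε j = bad t j).card := by
    intro ε
    obtain ⟨t, ht, hle⟩ := hcon ε
    refine le_trans ?_ (Finset.single_le_sum (fun t _ => by positivity) ht)
    have : (81 / 256 : ℝ) = (3 / 4) ^ 4 := by norm_num
    rw [this, ← pow_mul]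
    exact pow_le_pow_of_le_one (by norm_num) (by norm_num) hle
  have htot : (2 : ℝ) ^ m * (3 / 4) ^ m ≤ T.card * (1 + 81 / 256 : ℝ) ^ m := by
    calc (2 : ℝ) ^ m * (3 / 4) ^ m = ∑ _ε : ι → Bool, (3 / 4 : ℝ) ^ m := by simp [m]
      _ ≤ _ := Finset.sum_le_sum fun ε _ => hlow ε
      _ = _ := by
        rw [Finset.sum_comm, Finset.sum_congr rfl fun t _ => hsum t]
        simp
  have h1 : (T.card : ℝ) * (1 + 81 / 256 : ℝ) ^ m < (9 / 8) ^ m * (1 + 81 / 256 : ℝ) ^ m := by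
    gcongr
  rw [← mul_pow] at htot h1
  have h2 : ((9 / 8 : ℝ) * (1 + 81 / 256)) ^ m ≤ (2 * (3 / 4)) ^ m := by
    exact pow_le_pow_left₀ (by norm_num) (by norm_num) _
  linarith

section Bumps

open Metric

variable {d : ℕ}

lemma contDiff_pderiv' {f : EuclideanSpace ℝ (Fin d) → ℝ} (hf : ContDiff ℝ (⊤ : ℕ∞) f) (i : Fin d) :
    ContDiff ℝ (⊤ : ℕ∞) (pderiv' i f) :=
  (hf.fderiv_right (m := (⊤ : ℕ∞)) (by simp)).clm_apply contDiff_const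

lemma contDiff_iterPD (l : List (Fin d)) : ∀ {f : EuclideanSpace ℝ (Fin d) → ℝ}, ContDiff ℝ (⊤ : ℕ∞) f →
    ContDiff ℝ (⊤ : ℕ∞) (iterPD l f) := by
  induction l with
  | nil => intro f hf; exact hf
  | cons i l ih => intro f hf; exact ih (contDiff_pderiv' hf i)

lemma tsupport_pderiv'_subset (f : EuclideanSpace ℝ (Fin d) → ℝ) (i : Fin d) :
    tsupport (pderiv' i f) ⊆ tsupport f := by
  refine (closure_mono fun x hx => ?_).trans (tsupport_fderiv_subset ℝ (f := f))
  intro h0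
  exact hx (by simp [pderiv', h0])

lemma tsupport_iterPD_subset (l : List (Fin d)) : ∀ f : EuclideanSpace ℝ (Fin d) → ℝ,
    tsupport (iterPD l f) ⊆ tsupport f := by
  induction l with
  | nil => intro f; exact subset_rfl
  | cons i l ih => intro f; exact (ih _).trans (tsupport_pderiv'_subset f i)

lemma iterPD_sum_dilate {ι : Type*} [Fintype ι] (N : ℝ) (z : ι → EuclideanSpace ℝ (Fin d)) (l : List (Fin d)) :
    ∀ {f : EuclideanSpace ℝ (Fin d) → ℝ}, ContDiff ℝ (⊤ : ℕ∞) f → ∀ e : ι → ℝ,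
      iterPD l (fun x => ∑ j, e j * f (N • (x - z j)))
        = fun x => ∑ j, e j * N ^ l.length * iterPD l f (N • (x - z j)) := by
  induction l with
  | nil => intro f _ e; simp [iterPD]
  | cons i l ih =>
    intro f hf e
    have hd : Differentiable ℝ f := hf.differentiable (by simp)
    have h1 : pderiv' i (fun x => ∑ j, e j * f (N • (x - z j)))
        = fun x => ∑ j, e j * N * pderiv' i f (N • (x - z j)) := by
      funext x
      have hj : ∀ j, HasFDerivAt (fun x => e j * f (N • (x - z j)))
          (e j • (fderiv ℝ f (N • (x - z j))).comp (N • ContinuousLinearMap.id ℝ (EuclideanSpace ℝ (Fin d)))) x := by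
        intro j
        have h0 : HasFDerivAt (fun x : EuclideanSpace ℝ (Fin d) => N • (x - z j))
            (N • ContinuousLinearMap.id ℝ (EuclideanSpace ℝ (Fin d))) x :=
          ((hasFDerivAt_id x).sub_const _).const_smul N
        exact ((hd _).hasFDerivAt.comp x h0).const_mul (e j)
      have hs := HasFDerivAt.fun_sum (u := Finset.univ) fun j _ => hj j
      simp only [pderiv']
      rw [hs.fderiv]
      simp [mul_assoc]
    simp only [iterPD]
    rw [h1, ih (contDiff_pderiv' hf i)]
    funext x
    refine Finset.sum_congr rfl fun j _ => ?_
    rw [List.length_cons, pow_succ]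
    ring

/-- A smooth compactly supported function is Hölder, with any exponent in `(0, 1]`. -/
lemma exists_holder_bound {f : EuclideanSpace ℝ (Fin d) → ℝ} (hf : ContDiff ℝ (⊤ : ℕ∞) f)
    (hs : HasCompactSupport f) :
    ∃ M : ℝ, 0 < M ∧ ∀ v : ℝ, 0 < v → v ≤ 1 → ∀ x y, |f x - f y| ≤ M * ‖x - y‖ ^ v := by
  obtain ⟨M1, hM1⟩ := hs.exists_bound_of_continuous hf.continuous
  obtain ⟨M2, hM2⟩ := hf.lipschitzWith_of_hasCompactSupport hs (by simp)
  have hM10 : 0 ≤ M1 := (norm_nonneg _).trans (hM1 0)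
  refine ⟨2 * M1 + M2 + 1, by positivity, fun v hv hv1 x y => ?_⟩
  have hM20 : (0 : ℝ) ≤ M2 := M2.2
  rcases le_total ‖x - y‖ 1 with h | h
  · have h1 : |f x - f y| ≤ M2 * ‖x - y‖ := by
      simpa [Real.dist_eq, dist_eq_norm] using hM2.dist_le_mul x y
    have h2 : ‖x - y‖ ≤ ‖x - y‖ ^ v := by
      rcases (norm_nonneg (x - y)).eq_or_lt with h0 | h0
      · rw [← h0, Real.zero_rpow hv.ne']
      · simpa using Real.rpow_le_rpow_of_exponent_ge h0 h hv1
    calc |f x - f y| ≤ M2 * ‖x - y‖ := h1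
      _ ≤ (2 * M1 + M2 + 1) * ‖x - y‖ ^ v := by
        gcongr
        linarith
  · have h1 : |f x - f y| ≤ 2 * M1 := by
      have a1 := hM1 x
      have a2 := hM1 y
      rw [Real.norm_eq_abs] at a1 a2
      linarith [abs_sub (f x) (f y)]
    have h2 : 1 ≤ ‖x - y‖ ^ v := Real.one_le_rpow h hv.le
    calc |f x - f y| ≤ (2 * M1 + M2 + 1) * 1 := by linarith
      _ ≤ _ := by gcongr

/-- The centre of the grid cell of side `2 / N` with index `j`. -/
def cellCenter (d N : ℕ) (j : Fin d → Fin N) : EuclideanSpace ℝ (Fin d) :=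
  WithLp.toLp 2 fun i => -1 + (2 * (j i : ℝ) + 1) / N

lemma ball_cellCenter_subset_cube {N : ℕ} (hN : 0 < N) (j : Fin d → Fin N) :
    ball (cellCenter d N j) (1 / N) ⊆ cube d := by
  intro x hx i
  have hN' : (0 : ℝ) < N := by exact_mod_cast hN
  have h1 := (PiLp.norm_apply_le (x - cellCenter d N j) i).trans_lt (mem_ball_iff_norm.1 hx)
  rw [Real.norm_eq_abs] at h1
  have h3 : (x - cellCenter d N j) i = x i - (-1 + (2 * (j i : ℝ) + 1) / N) := rfl
  rw [h3, abs_lt] at h1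
  have h2 : ((j i : ℕ) : ℝ) + 1 ≤ N := by exact_mod_cast (j i).2
  have h4 : (2 * (j i : ℝ) + 1) / N + 1 / N ≤ 2 := by
    rw [← add_div, div_le_iff₀ hN']; linarith
  have h5 : 1 / (N : ℝ) ≤ (2 * (j i : ℝ) + 1) / N := by
    gcongr
    have : (0 : ℝ) ≤ (j i : ℕ) := Nat.cast_nonneg _
    linarith
  rw [abs_le]
  constructor <;> linarith

lemma disjoint_ball_cellCenter {N : ℕ} (hN : 0 < N) {j k : Fin d → Fin N} (hjk : j ≠ k) :
    Disjoint (ball (cellCenter d N j) (1 / N)) (ball (cellCenter d N k) (1 / N)) := by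
  have hN' : (0 : ℝ) < N := by exact_mod_cast hN
  refine ball_disjoint_ball ?_
  obtain ⟨i, hi⟩ := Function.ne_iff.1 hjk
  rw [dist_eq_norm]
  refine le_trans ?_ (PiLp.norm_apply_le _ i)
  have h3 : (cellCenter d N j - cellCenter d N k) i = 2 * ((j i : ℝ) - (k i : ℝ)) / N := by
    change (-1 + (2 * (j i : ℝ) + 1) / N) - (-1 + (2 * (k i : ℝ) + 1) / N) = _
    ring
  rw [h3, Real.norm_eq_abs, abs_div, abs_mul, abs_of_pos hN', ← add_div, abs_two]
  gcongr
  have h4 : (1 : ℝ) ≤ |(j i : ℝ) - (k i : ℝ)| := by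
    have hne : ((j i : ℕ) : ℤ) - ((k i : ℕ) : ℤ) ≠ 0 := by
      rw [sub_ne_zero]
      exact_mod_cast fun h => hi (Fin.ext h)
    have := Int.one_le_abs hne
    exact_mod_cast this
  linarith

lemma measurableSet_cube : MeasurableSet (cube d) := by
  have : cube d = ⋂ i, {x : EuclideanSpace ℝ (Fin d) | |x i| ≤ 1} := by ext; simp [cube]
  rw [this]
  exact MeasurableSet.iInter fun i => (isClosed_le (by fun_prop) continuous_const).measurableSet

lemma isCompact_cube : IsCompact (cube d) := by
  have hcl : IsClosed (cube d) := by
    have : cube d = ⋂ i, {x : EuclideanSpace ℝ (Fin d) | |x i| ≤ 1} := by ext; simp [cube]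
    rw [this]
    exact isClosed_iInter fun i => isClosed_le (by fun_prop) continuous_const
  refine Metric.isCompact_of_isClosed_isBounded hcl ?_
  refine (Metric.isBounded_closedBall (x := (0 : EuclideanSpace ℝ (Fin d))) (r := √d)).subset fun x hx => ?_
  rw [mem_closedBall_zero_iff, EuclideanSpace.norm_eq]
  refine Real.sqrt_le_sqrt ?_
  calc ∑ i, ‖x i‖ ^ 2 ≤ ∑ _i : Fin d, (1 : ℝ) := by
        gcongr with i
        have := hx i
        rw [← Real.norm_eq_abs] at this
        exact pow_le_one₀ (norm_nonneg _) this
    _ = d := by simp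

/-- Sum over a family with pairwise disjoint supports: at most two terms contribute to a
difference of two values. -/
lemma abs_sum_sub_le_of_disjoint {ι X : Type*} [Fintype ι] {Q : ι → Set X}
    (hQ : Pairwise (Function.onFun Disjoint Q)) {g : ι → X → ℝ}
    (hg : ∀ j, ∀ x ∉ Q j, g j x = 0) {x y : X} {B : ℝ} (hB0 : 0 ≤ B)
    (hB : ∀ j, |g j x - g j y| ≤ B) : |∑ j, g j x - ∑ j, g j y| ≤ 2 * B := by
  classical
  have hone : ∀ w : X, (Finset.univ.filter fun j => w ∈ Q j).card ≤ 1 := by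
    intro w
    refine Finset.card_le_one.2 fun j hj k hk => ?_
    by_contra hjk
    exact Set.disjoint_left.1 (hQ hjk) (Finset.mem_filter.1 hj).2 (Finset.mem_filter.1 hk).2
  set J := (Finset.univ.filter fun j => x ∈ Q j) ∪ (Finset.univ.filter fun j => y ∈ Q j)
  have hJ : (J.card : ℝ) ≤ 2 := by
    exact_mod_cast (Finset.card_union_le _ _).trans (add_le_add (hone x) (hone y))
  rw [← Finset.sum_sub_distrib, ← Finset.sum_subset (Finset.subset_univ J)]
  · calc |∑ j ∈ J, (g j x - g j y)| ≤ ∑ j ∈ J, |g j x - g j y| := Finset.abs_sum_le_sum_abs _ _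
      _ ≤ ∑ _j ∈ J, B := Finset.sum_le_sum fun j _ => hB j
      _ = J.card * B := by simp
      _ ≤ 2 * B := by gcongr
  · intro j _ hj
    simp only [J, Finset.mem_union, Finset.mem_filter, Finset.mem_univ, true_and, not_or] at hj
    rw [hg j x hj.1, hg j y hj.2, sub_zero]

/-- Families of bumps on a grid of `N ^ d` cells, all of whose signed sums lie in `LipClass`. -/
lemma exists_bumps (d s : ℕ) {v c0 : ℝ} (hv : 0 < v) (hv1 : v ≤ 1) (hc0 : 0 < c0) :
    ∃ τ : ℝ, 0 < τ ∧ ∀ N : ℕ, 0 < N → ∃ (u : (Fin d → Fin N) → EuclideanSpace ℝ (Fin d) → ℝ),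
      (∀ j, Continuous (u j)) ∧
      (∀ j, ∀ x ∉ ball (cellCenter d N j) (1 / N), u j x = 0) ∧
      (∀ j, τ * (N : ℝ) ^ (-(s + v)) * ((N : ℝ) ^ d)⁻¹
        ≤ ∫ x in ball (cellCenter d N j) (1 / N), u j x) ∧
      ∀ e : (Fin d → Fin N) → ℝ, (∀ j, |e j| ≤ 1) →
        (fun x => ∑ j, e j * u j x) ∈ LipClass d s v c0 := by
  let φ : ContDiffBump (0 : EuclideanSpace ℝ (Fin d)) := ⟨1 / 4, 1 / 2, by norm_num, by norm_num⟩
  have hφ : ContDiff ℝ (⊤ : ℕ∞) (φ : EuclideanSpace ℝ (Fin d) → ℝ) := φ.contDiff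
  have hsupp : ∀ l : List (Fin d), ∀ x : EuclideanSpace ℝ (Fin d), 1 ≤ ‖x‖ → iterPD l φ x = 0 := by
    intro l x hx
    refine image_eq_zero_of_notMem_tsupport fun hmem => ?_
    have h1 := tsupport_iterPD_subset l _ hmem
    rw [φ.tsupport_eq, mem_closedBall_zero_iff] at h1
    have h2 : ‖x‖ ≤ 1 / 2 := h1
    linarith
  have hcpt : ∀ l : List (Fin d), HasCompactSupport (iterPD l φ) := fun l =>
    φ.hasCompactSupport.of_isClosed_subset (isClosed_tsupport _) (tsupport_iterPD_subset l _)
  choose M hM0 hM using fun l : List (Fin d) =>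
    exists_holder_bound (contDiff_iterPD l hφ) (hcpt l)
  obtain ⟨M', hM'⟩ : ∃ M' : ℝ, ∀ l : List (Fin d), l.length = s → M l ≤ M' := by
    obtain ⟨M', h⟩ := ((List.finite_length_eq (Fin d) s).image M).bddAbove
    exact ⟨M', fun l hl => h ⟨l, hl, rfl⟩⟩
  set K := max M' 1
  have hK : 0 < K := by positivity
  set a := c0 / (2 * K)
  have ha : 0 < a := by positivity
  have hφi : 0 < ∫ x, φ x := φ.integral_pos
  refine ⟨a * ∫ x, φ x, by positivity, fun N hN => ?_⟩
  have hN' : (0 : ℝ) < N := by exact_mod_cast hN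
  set A := a * (N : ℝ) ^ (-(s + v)) with hA
  have hA0 : 0 < A := by positivity
  have hout : ∀ (l : List (Fin d)) (j : Fin d → Fin N),
      ∀ x ∉ ball (cellCenter d N j) (1 / N), iterPD l φ ((N : ℝ) • (x - cellCenter d N j)) = 0 := by
    intro l j x hx
    refine hsupp l _ ?_
    rw [mem_ball_iff_norm, not_lt, div_le_iff₀ hN'] at hx
    rw [norm_smul, Real.norm_eq_abs, abs_of_pos hN']
    linarith
  have hzero : ∀ j, ∀ x ∉ ball (cellCenter d N j) (1 / N),
      A * φ ((N : ℝ) • (x - cellCenter d N j)) = 0 := fun j x hx => by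
    rw [show φ ((N : ℝ) • (x - cellCenter d N j)) = 0 from hout [] j x hx, mul_zero]
  refine ⟨fun j x => A * φ ((N : ℝ) • (x - cellCenter d N j)), fun j => ?_, fun j x hx => ?_,
    fun j => ?_, fun e he => ?_⟩
  · exact continuous_const.mul (φ.continuous.comp (by fun_prop))
  · exact hzero j x hx
  · rw [setIntegral_eq_integral_of_forall_compl_eq_zero (hzero j),
      integral_const_mul, integral_sub_right_eq_self (fun x => φ ((N : ℝ) • x)),
      Measure.integral_comp_smul, abs_of_pos (by positivity)]
    simp only [finrank_euclideanSpace, Fintype.card_fin, smul_eq_mul]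
    refine le_of_eq ?_
    rw [hA]; ring
  · have hform : (fun x => ∑ j, e j * (A * φ ((N : ℝ) • (x - cellCenter d N j))))
        = fun x => ∑ j, (e j * A) * φ ((N : ℝ) • (x - cellCenter d N j)) := by
      funext x
      exact Finset.sum_congr rfl fun j _ => by ring
    rw [hform]
    refine ⟨?_, fun l hl x _ y _ => ?_⟩
    · refine ContDiff.sum fun j _ => contDiff_const.mul (φ.contDiff.comp ?_)
      fun_prop
    · rw [iterPD_sum_dilate (N : ℝ) (cellCenter d N) l hφ]
      have hNn : A * (N : ℝ) ^ l.length * (N : ℝ) ^ v = a := by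
        rw [hA, hl, mul_assoc, mul_assoc, ← Real.rpow_natCast, ← Real.rpow_add hN',
          ← Real.rpow_add hN', show -((s : ℝ) + v) + (s + v) = 0 by ring, Real.rpow_zero, mul_one]
      have hb : ∀ j, |e j * A * (N : ℝ) ^ l.length * iterPD l φ ((N : ℝ) • (x - cellCenter d N j))
          - e j * A * (N : ℝ) ^ l.length * iterPD l φ ((N : ℝ) • (y - cellCenter d N j))|
          ≤ a * K * ‖x - y‖ ^ v := by
        intro j
        have h1 := hM l v hv hv1 ((N : ℝ) • (x - cellCenter d N j))
          ((N : ℝ) • (y - cellCenter d N j))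
        rw [← smul_sub, sub_sub_sub_cancel_right, norm_smul, Real.norm_eq_abs, abs_of_pos hN',
          Real.mul_rpow hN'.le (norm_nonneg _)] at h1
        rw [← mul_sub, abs_mul, abs_mul, abs_mul, abs_of_pos hA0,
          abs_of_pos (pow_pos hN' l.length)]
        calc _ ≤ 1 * A * (N : ℝ) ^ l.length * (M l * ((N : ℝ) ^ v * ‖x - y‖ ^ v)) := by
              gcongr
              exact he j
          _ = (A * (N : ℝ) ^ l.length * (N : ℝ) ^ v) * M l * ‖x - y‖ ^ v := by ring
          _ ≤ a * K * ‖x - y‖ ^ v := by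
              rw [hNn]
              gcongr
              exact (hM' l hl).trans (le_max_left _ _)
      have := abs_sum_sub_le_of_disjoint
        (Q := fun j => ball (cellCenter d N j) (1 / N))
        (g := fun j x => e j * A * (N : ℝ) ^ l.length *
          iterPD l φ ((N : ℝ) • (x - cellCenter d N j)))
        (fun j k hjk => disjoint_ball_cellCenter hN hjk)
        (fun j x hx => by simp only [hout l j x hx, mul_zero]) (by positivity) hb
      refine this.trans (le_of_eq ?_)
      simp only [a]
      field_simp

/-- Some function of `LipClass` is far in `L¹` from each of few given continuous functions. -/
lemma exists_far_function (d s : ℕ) {v c0 : ℝ} (hv : 0 < v) (hv1 : v ≤ 1) (hc0 : 0 < c0) :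
    ∃ τ : ℝ, 0 < τ ∧ ∀ N : ℕ, 0 < N → ∀ T : Finset (EuclideanSpace ℝ (Fin d) → ℝ), (∀ t ∈ T, Continuous t) →
      (T.card : ℝ) < (9 / 8 : ℝ) ^ (N ^ d) →
      ∃ f ∈ LipClass d s v c0, ∀ t ∈ T, τ * (N : ℝ) ^ (-(s + v)) ≤ L1dist f t := by
  obtain ⟨τ, hτ, H⟩ := exists_bumps d s hv hv1 hc0
  refine ⟨τ / 4, by positivity, fun N hN T hT hcard => ?_⟩
  obtain ⟨u, hu, hu0, hint, hlip⟩ := H N hN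
  have hN' : (0 : ℝ) < N := by exact_mod_cast hN
  set Q : (Fin d → Fin N) → Set (EuclideanSpace ℝ (Fin d)) := fun j => ball (cellCenter d N j) (1 / N) with hQ
  have hdisj : Pairwise (Function.onFun Disjoint Q) := fun j k => disjoint_ball_cellCenter hN
  have hQc : ∀ j, Q j ⊆ cube d := ball_cellCenter_subset_cube hN
  set w := τ * (N : ℝ) ^ (-(s + v)) * ((N : ℝ) ^ d)⁻¹ with hw
  have hw0 : 0 < w := by positivity
  have hcint : ∀ g : EuclideanSpace ℝ (Fin d) → ℝ, Continuous g → IntegrableOn g (cube d) := fun g hg =>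
    hg.continuousOn.integrableOn_compact isCompact_cube
  have hQint : ∀ g : EuclideanSpace ℝ (Fin d) → ℝ, Continuous g → ∀ j, IntegrableOn g (Q j) := fun g hg j =>
    (hcint g hg).mono_set (hQc j)
  have hcell : Fintype.card (Fin d → Fin N) = N ^ d := by simp
  classical
  obtain ⟨ε, hε⟩ := exists_signs_card_lt T
    (fun t j => decide (w ≤ ∫ x in Q j, |1 * u j x - t x|)) (by rwa [hcell])
  set e : (Fin d → Fin N) → ℝ := fun j => if ε j then 1 else -1 with he
  have he1 : ∀ j, |e j| ≤ 1 := fun j => by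
    by_cases h : ε j <;> simp [he, h]
  refine ⟨_, hlip e he1, fun t ht => ?_⟩
  have htc := hT t ht
  set f : EuclideanSpace ℝ (Fin d) → ℝ := fun x => ∑ j, e j * u j x with hf
  have hfc : Continuous f := continuous_finsetSum _ fun j _ => continuous_const.mul (hu j)
  have hgood : ∀ j, ε j = decide (w ≤ ∫ x in Q j, |1 * u j x - t x|) →
      w ≤ ∫ x in Q j, |f x - t x| := by
    intro j hj
    have hfj : ∫ x in Q j, |f x - t x| = ∫ x in Q j, |e j * u j x - t x| := by
      refine setIntegral_congr_fun measurableSet_ball fun x hx => ?_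
      have : f x = e j * u j x := by
        refine Finset.sum_eq_single j (fun k _ hk => ?_) (by simp)
        rw [hu0 k x (fun hxk => Set.disjoint_left.1 (hdisj hk) hxk hx), mul_zero]
      simp only [this]
    rw [hfj]
    by_cases hc : w ≤ ∫ x in Q j, |1 * u j x - t x|
    · have hεj : ε j = true := by rw [hj]; simpa using hc
      simpa only [he, hεj, if_true] using hc
    · have hεj : ε j = false := by rw [hj]; simpa using hc
      have hej : e j = -1 := by simp [he, hεj]
      rw [hej]
      have hi1 : IntegrableOn (fun x => |1 * u j x - t x|) (Q j) :=
        hQint _ ((continuous_const.mul (hu j)).sub htc).abs j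
      have hi2 : IntegrableOn (fun x => |-1 * u j x - t x|) (Q j) :=
        hQint _ ((continuous_const.mul (hu j)).sub htc).abs j
      have h2 : ∫ x in Q j, 2 * u j x ≤
          ∫ x in Q j, (|1 * u j x - t x| + |-1 * u j x - t x|) := by
        refine setIntegral_mono (hQint _ (continuous_const.mul (hu j)) j) (hi1.add hi2) fun x => ?_
        have a1 := le_abs_self (1 * u j x - t x)
        have a2 := neg_abs_le (-1 * u j x - t x)
        dsimp only
        linarith
      rw [integral_add hi1 hi2, integral_const_mul] at h2
      have h3 := hint j
      push Not at hc
      linarith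
  have hft : Continuous fun x => |f x - t x| := (hfc.sub htc).abs
  have hsum : ∑ j, ∫ x in Q j, |f x - t x| ≤ L1dist f t := by
    rw [← integral_iUnion_fintype (s := Q) (fun j => measurableSet_ball) hdisj
      (fun j => hQint _ hft j)]
    exact setIntegral_mono_set (hcint _ hft)
      (Filter.Eventually.of_forall fun x => abs_nonneg _)
      (Set.iUnion_subset hQc).eventuallyLE
  set J := Finset.univ.filter fun j => ε j = decide (w ≤ ∫ x in Q j, |1 * u j x - t x|) with hJ
  have hJc : ((N : ℝ) ^ d) ≤ 4 * J.card := by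
    have h := hε t ht
    rw [hcell] at h
    exact_mod_cast h.le
  calc τ / 4 * (N : ℝ) ^ (-(s + v)) = (N : ℝ) ^ d / 4 * w := by
        rw [hw]; field_simp
    _ ≤ J.card * w := by gcongr; linarith
    _ = ∑ _j ∈ J, w := by simp
    _ ≤ ∑ j ∈ J, ∫ x in Q j, |f x - t x| :=
        Finset.sum_le_sum fun j hj => hgood j (Finset.mem_filter.1 hj).2
    _ ≤ ∑ j, ∫ x in Q j, |f x - t x| :=
        Finset.sum_le_sum_of_subset_of_nonneg (Finset.subset_univ _) fun j _ _ =>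
          integral_nonneg fun x => abs_nonneg _
    _ ≤ L1dist f t := hsum

lemma L1dist_le_add {f g h : EuclideanSpace ℝ (Fin d) → ℝ} (hf : Continuous f) (hg : Continuous g)
    (hh : Continuous h) : L1dist f g ≤ L1dist f h + L1dist h g := by
  have hint : ∀ {g h : EuclideanSpace ℝ (Fin d) → ℝ}, Continuous g → Continuous h →
      IntegrableOn (fun x => |g x - h x|) (cube d) := fun hg hh =>
    (hg.sub hh).abs.continuousOn.integrableOn_compact isCompact_cube
  unfold L1dist
  rw [← integral_add (hint hf hh) (hint hh hg)]
  exact setIntegral_mono (hint hf hg) ((hint hf hh).add (hint hh hg)) fun x => abs_sub_le _ _ _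

lemma L1dist_le_of_abs_sub_le {f g : EuclideanSpace ℝ (Fin d) → ℝ} {δ : ℝ} (h : ∀ x ∈ cube d, |f x - g x| ≤ δ) :
    L1dist f g ≤ δ * volume.real (cube d) := by
  have := norm_setIntegral_le_of_norm_le_const (μ := volume) (f := fun x => |f x - g x|)
    (isCompact_cube (d := d)).measure_lt_top (fun x hx => by simpa using h x hx)
  exact (le_abs_self _).trans this

end Bumps

lemma card_exponent_lt {A β ρ q y L n l x : ℝ} (hA : 0 ≤ A) (hβ : 0 ≤ β) (hρ : 0 ≤ ρ)
    (hq : 1 ≤ q) (hAq : 10 * (A + 3 * β + 3 * ρ) ≤ q) (hL : 1 ≤ L) (hn : 1 ≤ n) (hl : 1 ≤ l)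
    (hln : Real.log n ≤ l) (hx : 1 ≤ x) (hy : q ^ 2 * (L ^ 2 * n * l * x) ≤ y) :
    n * (A + (L + 2) * (β * x) + ρ * Real.log y) < y / 9 := by
  have hn0 : 0 < n := by linarith
  have hqq : q ≤ q ^ 2 := by nlinarith
  have hq0 : 0 < q := by linarith
  have hLL : L ≤ L ^ 2 := by nlinarith
  have e1 : q ^ 2 * n ≤ y := by
    refine le_trans ?_ hy
    have : 1 ≤ L ^ 2 * l * x := one_le_mul_of_one_le_of_one_le
      (one_le_mul_of_one_le_of_one_le (by linarith) hl) hx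
    calc q ^ 2 * n = q ^ 2 * n * 1 := by ring
      _ ≤ q ^ 2 * n * (L ^ 2 * l * x) := by gcongr
      _ = _ := by ring
  have e2 : q * (n * (L * x)) ≤ y := by
    refine le_trans ?_ hy
    calc q * (n * (L * x)) = q * (L * n * 1 * x) := by ring
      _ ≤ q ^ 2 * (L ^ 2 * n * l * x) := by gcongr
  have e3 : q * (n * l) ≤ y := by
    refine le_trans ?_ hy
    calc q * (n * l) = q * (1 * n * l * 1) := by ring
      _ ≤ q ^ 2 * (L ^ 2 * n * l * x) := by gcongr; linarith
  have hy0 : 0 < y := lt_of_lt_of_le (by positivity) e1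
  set z := √(y / n)
  have hz : z ^ 2 = y / n := Real.sq_sqrt (by positivity)
  have hz0 : 0 < z := Real.sqrt_pos.2 (by positivity)
  have hqz : q ≤ z := Real.le_sqrt_of_sq_le (by rwa [le_div_iff₀ hn0])
  have hyz : y = n * z ^ 2 := by rw [hz]; field_simp
  have hlog : Real.log y ≤ l + 2 * z := by
    rw [hyz, Real.log_mul hn0.ne' (by positivity), Real.log_pow]
    have := Real.log_le_sub_one_of_pos hz0
    push_cast
    linarith
  have e4 : q * (n * z) ≤ y := by
    rw [hyz]
    nlinarith [mul_le_mul_of_nonneg_right hqz (mul_pos hn0 hz0).le]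
  have e5 : q * n ≤ y := le_trans (by gcongr) e1
  have t1 : q * (n * A) ≤ A * y := by nlinarith
  have t2 : q * (n * ((L + 2) * (β * x))) ≤ 3 * β * y := by
    calc q * (n * ((L + 2) * (β * x))) ≤ q * (n * ((3 * L) * (β * x))) := by gcongr; linarith
      _ = 3 * β * (q * (n * (L * x))) := by ring
      _ ≤ _ := by gcongr
  have t3 : q * (n * (ρ * Real.log y)) ≤ 3 * ρ * y := by
    calc q * (n * (ρ * Real.log y)) ≤ q * (n * (ρ * (l + 2 * z))) := by gcongr
      _ = ρ * (q * (n * l) + 2 * (q * (n * z))) := by ring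
      _ ≤ ρ * (y + 2 * y) := by gcongr
      _ = _ := by ring
  have t4 : q * (n * (A + (L + 2) * (β * x) + ρ * Real.log y)) ≤ q * (y / 10) := by
    have : (10 * (A + 3 * β + 3 * ρ)) * y ≤ q * y := by gcongr
    linarith
  have := le_of_mul_le_mul_left t4 hq0
  linarith

lemma exists_grid_size {d : ℕ} (hd : 1 ≤ d) {r κ M : ℝ} (hr : 0 < r) (hκ : 1 ≤ κ) (hM : 1 ≤ M) :
    ∃ N : ℕ, 0 < N ∧ κ * M ≤ (N : ℝ) ^ d ∧
      (2 : ℝ) ^ (-r) * κ ^ (-(r / d)) * M ^ (-(r / d)) ≤ (N : ℝ) ^ (-r) := by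
  have hd0 : (0 : ℝ) < d := by exact_mod_cast hd
  have hκM : 1 ≤ κ * M := one_le_mul_of_one_le_of_one_le hκ hM
  set P := (κ * M) ^ (1 / (d : ℝ)) with hP
  have hP1 : 1 ≤ P := Real.one_le_rpow hκM (by positivity)
  have hN0 : 0 < ⌈P⌉₊ := Nat.ceil_pos.2 (by linarith)
  refine ⟨⌈P⌉₊, hN0, ?_, ?_⟩
  · calc κ * M = P ^ d := by
          rw [hP, ← Real.rpow_natCast, ← Real.rpow_mul (by linarith), one_div,
            inv_mul_cancel₀ hd0.ne', Real.rpow_one]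
      _ ≤ (⌈P⌉₊ : ℝ) ^ d := by
          gcongr
          exact Nat.le_ceil P
  · have hNP : (⌈P⌉₊ : ℝ) ≤ 2 * P := by
      have := Nat.ceil_lt_add_one (a := P) (by linarith)
      linarith
    have hPr : P ^ (-r) = κ ^ (-(r / d)) * M ^ (-(r / d)) := by
      rw [← Real.mul_rpow (by linarith) (by linarith), hP,
        ← Real.rpow_mul (by linarith)]
      congr 1
      ring
    rw [mul_assoc, ← hPr, ← Real.mul_rpow (by norm_num) (by linarith)]
    exact Real.rpow_le_rpow_of_nonpos (by exact_mod_cast hN0) hNP (by linarith)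

lemma log_net_count_le {τ V R B r N : ℝ} {L : ℕ} (hτ : 0 < τ) (hV : 1 ≤ V) (hR : 1 ≤ R)
    (hRB : R ≤ B) (hr : 0 ≤ r) (hN : 1 ≤ N) :
    Real.log (2 * R / (τ * N ^ (-r) / (2 * V * B ^ (L + 1))) + 1)
      ≤ Real.log (4 * V / τ + 1) + (L + 2) * Real.log B + r * Real.log N := by
  have hN0 : 0 < N := by linarith
  have hB : 1 ≤ B := hR.trans hRB
  have hB0 : 0 < B := by linarith
  have hV0 : 0 < V := by linarith
  have e1 : 2 * R / (τ * N ^ (-r) / (2 * V * B ^ (L + 1)))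
      = 4 * V / τ * (R * B ^ (L + 1)) * N ^ r := by
    rw [Real.rpow_neg hN0.le]; field_simp; ring
  have e2 : R * B ^ (L + 1) ≤ B ^ (L + 2) := by
    rw [pow_succ' B (L + 1)]; gcongr
  have e3 : 1 ≤ B ^ (L + 2) * N ^ r :=
    one_le_mul_of_one_le_of_one_le (one_le_pow₀ hB) (Real.one_le_rpow hN hr)
  have h1 : 4 * V / τ * (R * B ^ (L + 1)) * N ^ r + 1
      ≤ (4 * V / τ + 1) * B ^ (L + 2) * N ^ r := by
    calc _ ≤ 4 * V / τ * B ^ (L + 2) * N ^ r + B ^ (L + 2) * N ^ r := by gcongr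
      _ = _ := by ring
  rw [e1]
  refine (Real.log_le_log (by positivity) h1).trans (le_of_eq ?_)
  rw [Real.log_mul (by positivity) (by positivity), Real.log_mul (by positivity)
    (by positivity), Real.log_rpow hN0, Real.log_pow]
  push_cast
  ring

/-- Theorem 2 of the paper: lower bound for approximation of
`Lip^{(r,c₀)}` by deep nets with fixed structure, `n` free parameters, depth `L` and
weights and thresholds bounded by `R`:
`dist(Lip^{(r,c₀)}, H_{n,L,σ,R}, L¹(𝕀^d)) ≥ C [L² n log₂ n log₂(R D_max)]^{-r/d}`,
where `C > 0` depends only on `c`, `c₀`, `c₁`, `d` and `r`.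
(The lower bound on the sup-inf distance is expressed by: for every `C'` below the
claimed bound there is `f ∈ Lip^{(r,c₀)}` whose `L¹`-distance to every member of the
class is at least `C'`.) -/
theorem stmt3 (d s : ℕ) (hd : 1 ≤ d) (v c0 c c1 r : ℝ) (hv : 0 < v) (hv1 : v ≤ 1)
    (hc0 : 0 < c0) (hc : 1 ≤ c) (hc1 : 1 ≤ c1) (hr : r = s + v) :
    ∃ C : ℝ, 0 < C ∧
      ∀ (L n : ℕ), 1 ≤ L → 2 ≤ n → ∀ R : ℝ, 1 ≤ R →
        ∀ σ : ℕ → ℝ → ℝ,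
          (∀ k, 1 ≤ k → k ≤ L → ∀ t t' : ℝ, |σ k t - σ k t'| ≤ c1 * |t - t'|) →
          (∀ k, 1 ≤ k → k ≤ L → ∀ t : ℝ, |σ k t| ≤ c * (|t| + 1)) →
          ∀ dims : ℕ → ℕ,
            2 ≤ R * (((Finset.range (L + 1)).sup (dimAt d dims) : ℕ) : ℝ) →
            ∀ S : NetStructure n L d dims,
              ∀ C' : ℝ,
                C' < C * ((L : ℝ) ^ 2 * (n : ℝ) * Real.logb 2 (n : ℝ) *
                      Real.logb 2
                        (R * (((Finset.range (L + 1)).sup (dimAt d dims) : ℕ) : ℝ))) ^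
                    (-(r / d)) →
                ∃ f ∈ LipClass d s v c0, ∀ h ∈ netClass S σ R, C' ≤ L1dist f h := by
  obtain ⟨τ, hτ, hfar⟩ := exists_far_function d s hv hv1 hc0
  set V := volume.real (cube d) + 1 with hV
  have hV1 : 1 ≤ V := by
    have : 0 ≤ volume.real (cube d) := measureReal_nonneg
    linarith
  have hr0 : 0 < r := by rw [hr]; positivity
  have hd0 : (0 : ℝ) < d := by exact_mod_cast hd
  have hcc : 1 ≤ c * c1 := one_le_mul_of_one_le_of_one_le hc hc1
  set G := 4 * V / τ + 1 with hG
  have hG1 : 1 ≤ G := by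
    have : 0 ≤ 4 * V / τ := by positivity
    linarith
  have hlogG : 0 ≤ Real.log G := Real.log_nonneg hG1
  set β := Real.log (3 * c * c1) + 1 with hβ
  have hβ0 : 0 ≤ Real.log (3 * c * c1) := Real.log_nonneg (by linarith)
  set q := 10 * (Real.log G + 3 * β + 3 * (r / d)) + 1 with hq
  have hrd : 0 < r / d := by positivity
  have hq1 : 1 ≤ q := by linarith
  set κ := q ^ 2 with hκ
  have hκ1 : 1 ≤ κ := one_le_pow₀ hq1
  refine ⟨τ / 2 * ((2 : ℝ) ^ (-r) * κ ^ (-(r / d))), by positivity, ?_⟩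
  intro L n hL hn R hR σ hlip hgrow dims hX S C' hC'
  set D : ℝ := (((Finset.range (L + 1)).sup (dimAt d dims) : ℕ) : ℝ) with hD
  have hdim : ∀ k ≤ L, ((dimAt d dims k : ℕ) : ℝ) ≤ D := fun k hk => dimAt_le_sup hk
  have hD1 : 1 ≤ D := le_trans (by exact_mod_cast hd) (hdim 0 (Nat.zero_le _))
  set x := Real.logb 2 (R * D) with hx
  have hx1 : 1 ≤ x := by
    rw [hx, Real.le_logb_iff_rpow_le (by norm_num) (by linarith)]; simpa using hX
  set l := Real.logb 2 (n : ℝ) with hl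
  have hn2 : (2 : ℝ) ≤ n := by exact_mod_cast hn
  have hl1 : 1 ≤ l := by
    rw [hl, Real.le_logb_iff_rpow_le (by norm_num) (by linarith)]; simpa using hn2
  have hlog2 : Real.log 2 ≤ 1 := Real.log_two_lt_d9.le.trans (by norm_num)
  have hlog2' : 0 < Real.log 2 := Real.log_pos (by norm_num)
  have hlogb : ∀ t : ℝ, 1 ≤ Real.logb 2 t → Real.log t ≤ Real.logb 2 t := fun t ht => by
    have : Real.log t = Real.log 2 * Real.logb 2 t := by rw [Real.logb]; field_simp
    rw [this]; nlinarith
  set M := (L : ℝ) ^ 2 * n * l * x with hM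
  have hL1 : (1 : ℝ) ≤ L := by exact_mod_cast hL
  have hM1 : 1 ≤ M := by
    have h1 : (1 : ℝ) ≤ (L : ℝ) ^ 2 := one_le_pow₀ hL1
    exact one_le_mul_of_one_le_of_one_le (one_le_mul_of_one_le_of_one_le
      (one_le_mul_of_one_le_of_one_le h1 (by linarith)) hl1) hx1
  obtain ⟨N, hN0, hy, hrate⟩ := exists_grid_size hd hr0 hκ1 hM1
  have hN1 : (1 : ℝ) ≤ N := by exact_mod_cast hN0
  have hN' : (0 : ℝ) < N := by linarith
  set B := 3 * c * c1 * (R * D) with hB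
  have hXB : R * D ≤ B := by
    rw [hB]
    exact le_mul_of_one_le_left (by linarith) (by linarith)
  have hRB : R ≤ B := le_trans (le_mul_of_one_le_right (by linarith) hD1) hXB
  have hB1 : 1 ≤ B := hR.trans hRB
  have hlogB : Real.log B ≤ β * x := by
    rw [hB, Real.log_mul (by positivity) (by positivity), hβ]
    have h1 := hlogb (R * D) hx1
    have h2 : Real.log (3 * c * c1) ≤ Real.log (3 * c * c1) * x :=
      le_mul_of_one_le_right hβ0 hx1
    linarith
  set η := τ * (N : ℝ) ^ (-r) / (2 * V * B ^ (L + 1)) with hη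
  have hη0 : 0 < η := by positivity
  obtain ⟨T, hTc, hTcard, hTnet⟩ := exists_finset_net S hc hc1 hR hD1 hdim hlip hgrow hη0
  have hcount : (T.card : ℝ) < (9 / 8 : ℝ) ^ (N ^ d) := by
    have h2 : Real.log (2 * R / η + 1) ≤
        Real.log G + (L + 2) * (β * x) + r / d * Real.log ((N : ℝ) ^ d) := by
      refine (log_net_count_le (L := L) hτ hV1 hR hRB hr0.le hN1).trans ?_
      rw [Real.log_pow, show r / d * (d * Real.log N) = r * Real.log N by field_simp]
      gcongr
    have h3 := card_exponent_lt (β := β) (n := n) hlogG (by linarith) hrd.le hq1 (by linarith) hL1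
      (by linarith) hl1 (hlogb n hl1) hx1 hy
    have h4 : (1 / 9 : ℝ) ≤ Real.log (9 / 8) := by
      have := Real.one_sub_inv_le_log_of_pos (show (0 : ℝ) < 9 / 8 by norm_num)
      linarith
    refine hTcard.trans_lt ((Real.log_lt_log_iff (by positivity) (by positivity)).1 ?_)
    rw [Real.log_pow, Real.log_pow]
    push_cast
    calc (n : ℝ) * Real.log (2 * R / η + 1) ≤ _ := mul_le_mul_of_nonneg_left h2 (by linarith)
      _ < (N : ℝ) ^ d / 9 := h3
      _ = (N : ℝ) ^ d * (1 / 9) := by ring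
      _ ≤ _ := by gcongr
  obtain ⟨f, hf, hfT⟩ := hfar N hN0 T hTc hcount
  refine ⟨f, hf, fun h hh => ?_⟩
  obtain ⟨hhc, t, ht, hht⟩ := hTnet h hh
  have h1 := hfT t ht
  rw [← hr] at h1
  have h2 := L1dist_le_add hf.1.continuous (hTc t ht) hhc
  have h3 : L1dist h t ≤ τ * (N : ℝ) ^ (-r) / 2 := by
    refine (L1dist_le_of_abs_sub_le hht).trans ?_
    calc η * B ^ (L + 1) * volume.real (cube d) ≤ η * B ^ (L + 1) * V := by gcongr; linarith
      _ = _ := by rw [hη]; field_simp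
  have h4 : τ / 2 * ((2 : ℝ) ^ (-r) * κ ^ (-(r / d))) * M ^ (-(r / d))
      ≤ τ / 2 * (N : ℝ) ^ (-r) := by
    rw [mul_assoc]; gcongr
  linarith

end
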